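/- Let G be a free group with free basis a₁, …, aₙ, H a free group, and φ, ψ : G → H homomorphisms. If φ has remnant with |Rem_φ(aᵢ)| > |aᵢψ| for every i, then Eq(φ, ψ) = {1}. -/

import Mathlib

/-- The number of letters cancelled in the product `u * v` of elements of a free group:
`c(u,v) = (|u| + |v| - |uv|)/2`. -/
def cancel {κ : Type*} [DecidableEq κ] (u v : FreeGroup κ) : ℕ :=
  (FreeGroup.norm u + FreeGroup.norm v - FreeGroup.norm (u * v)) / 2

/-- The basis letter indexed by `(i, ε)`: `of i` if `ε = true`, `(of i)⁻¹` if `ε = false`. -/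
def bLetter {ι : Type*} (p : ι × Bool) : FreeGroup ι :=
  cond p.2 (FreeGroup.of p.1) (FreeGroup.of p.1)⁻¹

/-- `P_χ(x_i)`: maximal cancellation of `x_iχ` with the image of a basis letter `b ≠ x_i⁻¹`
multiplied on the left. -/
def Pc {ι κ : Type*} [Fintype ι] [DecidableEq ι] [DecidableEq κ]
    (χ : FreeGroup ι →* FreeGroup κ) (i : ι) : ℕ :=
  (Finset.univ.erase (i, false)).sup fun p => cancel (χ (bLetter p)) (χ (FreeGroup.of i))

/-- `S_χ(x_i)`: maximal cancellation of `x_iχ` with the image of a basis letter `b ≠ x_i⁻¹`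
multiplied on the right. -/
def Sc {ι κ : Type*} [Fintype ι] [DecidableEq ι] [DecidableEq κ]
    (χ : FreeGroup ι →* FreeGroup κ) (i : ι) : ℕ :=
  (Finset.univ.erase (i, false)).sup fun p => cancel (χ (FreeGroup.of i)) (χ (bLetter p))

/-- `χ` has remnant if for every basis element a nontrivial subword of its image survives
all the cancellations: `P_χ(x_i) + S_χ(x_i) < |x_iχ|`. -/
def HasRemnant {ι κ : Type*} [Fintype ι] [DecidableEq ι] [DecidableEq κ]
    (χ : FreeGroup ι →* FreeGroup κ) : Prop :=
  ∀ i : ι, Pc χ i + Sc χ i < FreeGroup.norm (χ (FreeGroup.of i))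

/-- The remnant length `|Rem_χ(x_i)| = |x_iχ| - P_χ(x_i) - S_χ(x_i)`. -/
def RemLen {ι κ : Type*} [Fintype ι] [DecidableEq ι] [DecidableEq κ]
    (χ : FreeGroup ι →* FreeGroup κ) (i : ι) : ℕ :=
  FreeGroup.norm (χ (FreeGroup.of i)) - Pc χ i - Sc χ i

theorem FreeGroup.IsReduced.exists_append_cancel {α : Type*} {L₁ L₂ : List (α × Bool)}
    (h₁ : IsReduced L₁) (h₂ : IsReduced L₂) :
    ∃ A B C, L₁ = A ++ C ∧ L₂ = invRev C ++ B ∧ IsReduced (A ++ B) := by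
  induction L₂ generalizing L₁ with
  | nil => exact ⟨L₁, [], [], by simp, by simp, by simpa using h₁⟩
  | cons y L₂ ih =>
    rcases L₁.eq_nil_or_concat with rfl | ⟨L, x, rfl⟩
    · exact ⟨[], y :: L₂, [], by simp, by simp, by simpa using h₂⟩
    rw [List.concat_eq_append] at h₁ ⊢
    by_cases hxy : x.1 = y.1 → x.2 = y.2
    · refine ⟨L ++ [x], y :: L₂, [], by simp, by simp, ?_⟩
      refine IsReduced.append_overlap h₁ ?_ (by simp)
      exact isReduced_cons_cons.2 ⟨hxy, h₂⟩
    · obtain ⟨A, B, C, rfl, rfl, h⟩ := ih (L₁ := L) (h₁.infix ⟨[], [x], by simp⟩)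
        (h₂.infix ⟨[y], [], by simp⟩)
      refine ⟨A, B, C ++ [x], by simp, ?_, h⟩
      obtain ⟨y₁, y₂⟩ := y
      obtain ⟨x₁, x₂⟩ := x
      simp only [Classical.not_imp] at hxy
      obtain ⟨rfl, h⟩ := hxy
      have : y₂ = !x₂ := by cases x₂ <;> cases y₂ <;> simp_all
      simp [invRev, this]

theorem FreeGroup.IsReduced.norm_mk {κ : Type*} [DecidableEq κ] {L : List (κ × Bool)}
    (h : IsReduced L) : norm (mk L) = L.length := by
  rw [norm, toWord_mk, h.reduce_eq]

open FreeGroup in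
theorem exists_cancel_decomposition {κ : Type*} [DecidableEq κ] (u v : FreeGroup κ) :
    ∃ A B C, u.toWord = A ++ C ∧ v.toWord = invRev C ++ B ∧ u * v = mk (A ++ B) ∧
      IsReduced (A ++ B) ∧ cancel u v = C.length := by
  obtain ⟨A, B, C, hu, hv, h⟩ :=
    (isReduced_toWord (x := u)).exists_append_cancel (isReduced_toWord (x := v))
  have huv : u * v = mk (A ++ B) := by
    rw [← mk_toWord (x := u), ← mk_toWord (x := v), hu, hv]
    simp only [← mul_mk, ← inv_mk]
    group
  refine ⟨A, B, C, hu, hv, huv, h, ?_⟩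
  rw [cancel, huv, h.norm_mk, FreeGroup.norm, FreeGroup.norm, hu, hv]
  simp only [List.length_append, invRev_length]
  omega

theorem norm_mul_add_two_mul_cancel {κ : Type*} [DecidableEq κ] (u v : FreeGroup κ) :
    FreeGroup.norm (u * v) + 2 * cancel u v = FreeGroup.norm u + FreeGroup.norm v := by
  obtain ⟨A, B, C, hu, hv, huv, h, hc⟩ := exists_cancel_decomposition u v
  rw [hc, huv, h.norm_mk, FreeGroup.norm, FreeGroup.norm, hu, hv]
  simp only [List.length_append, FreeGroup.invRev_length]
  omega

theorem cancel_inv_inv {κ : Type*} [DecidableEq κ] (u v : FreeGroup κ) :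
    cancel u⁻¹ v⁻¹ = cancel v u := by
  rw [cancel, cancel, ← mul_inv_rev]
  simp only [FreeGroup.norm_inv_eq, add_comm]

open FreeGroup in
/-- If the cancellations on the two sides of `v` in `u * v * w` do not meet, then they do not
interact. -/
theorem cancel_mul_right_of_lt {κ : Type*} [DecidableEq κ] {u v w : FreeGroup κ}
    (h : cancel u v + cancel v w < norm v) : cancel u (v * w) = cancel u v := by
  have hu_vw := norm_mul_add_two_mul_cancel u (v * w)
  have hu_v := norm_mul_add_two_mul_cancel u v
  obtain ⟨A, B, C, hu, hv, huv, hAB, hc⟩ := exists_cancel_decomposition u v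
  obtain ⟨A', B', C', hv', hw, hvw, hAB', hc'⟩ := exists_cancel_decomposition v w
  obtain ⟨M, rfl, rfl⟩ : ∃ M, A' = invRev C ++ M ∧ B = M ++ C' := by
    have hlen := congrArg List.length hv'
    rw [FreeGroup.norm] at h
    simp only [List.length_append] at hlen
    rcases List.append_eq_append_iff.1 (hv.symm.trans hv') with ⟨M, h₁, h₂⟩ | ⟨M, h₁, h₂⟩
    · exact ⟨M, h₁, h₂⟩
    · have := congrArg List.length h₁
      simp only [List.length_append, invRev_length] at this
      omega
  have hM : M ≠ [] := by
    rintro rfl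
    rw [FreeGroup.norm, hv] at h
    simp only [List.length_append, invRev_length, List.length_nil] at h
    omega
  have hred : IsReduced (A ++ M ++ B') :=
    IsReduced.append_overlap (hAB.infix ⟨[], C', by simp⟩)
      (hAB'.infix ⟨invRev C, [], by simp⟩) hM
  have huvw : u * (v * w) = mk (A ++ M ++ B') := by
    rw [hvw, ← mk_toWord (x := u), hu]
    simp only [← mul_mk, ← inv_mk]
    group
  have hn_vw := hAB'.norm_mk
  rw [← hvw] at hn_vw
  rw [huvw, hred.norm_mk, hn_vw, FreeGroup.norm, hu] at hu_vw
  rw [huv, hAB.norm_mk, FreeGroup.norm, FreeGroup.norm, hu, hv] at hu_v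
  simp only [List.length_append, invRev_length] at hu_vw hu_v
  omega

theorem bLetter_not {ι : Type*} (i : ι) (b : Bool) : bLetter (i, !b) = (bLetter (i, b))⁻¹ := by
  cases b <;> simp [bLetter]

theorem mk_cons_eq_bLetter_mul {ι : Type*} (p : ι × Bool) (L : List (ι × Bool)) :
    FreeGroup.mk (p :: L) = bLetter p * FreeGroup.mk L := by
  obtain ⟨i, b⟩ := p
  cases b <;> simp [bLetter, FreeGroup.of, FreeGroup.inv_mk, FreeGroup.mul_mk, FreeGroup.invRev]

theorem norm_map_bLetter {ι κ : Type*} [DecidableEq κ] (χ : FreeGroup ι →* FreeGroup κ)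
    (p : ι × Bool) :
    FreeGroup.norm (χ (bLetter p)) = FreeGroup.norm (χ (FreeGroup.of p.1)) := by
  obtain ⟨i, _ | _⟩ := p <;> simp [bLetter]

section

variable {ι κ : Type*} [Fintype ι] [DecidableEq ι] [DecidableEq κ]

/-- The maximal cancellation at the start of the image of a letter. -/
def leftCancel (χ : FreeGroup ι →* FreeGroup κ) (p : ι × Bool) : ℕ :=
  cond p.2 (Pc χ p.1) (Sc χ p.1)

/-- The maximal cancellation at the end of the image of a letter. -/
def rightCancel (χ : FreeGroup ι →* FreeGroup κ) (p : ι × Bool) : ℕ :=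
  cond p.2 (Sc χ p.1) (Pc χ p.1)

theorem cancel_le_leftCancel (χ : FreeGroup ι →* FreeGroup κ) {p q : ι × Bool}
    (h : p.1 = q.1 → p.2 = q.2) :
    cancel (χ (bLetter p)) (χ (bLetter q)) ≤ leftCancel χ q := by
  obtain ⟨i, b⟩ := p
  obtain ⟨j, _ | _⟩ := q
  · have hmem : (i, !b) ∈ Finset.univ.erase (j, false) := by
      cases b <;> simp_all
    have := Finset.le_sup
      (f := fun p => cancel (χ (FreeGroup.of j)) (χ (bLetter p))) hmem
    rw [← cancel_inv_inv, ← map_inv, ← map_inv, ← bLetter_not, ← bLetter_not]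
    exact this
  · have hmem : (i, b) ∈ Finset.univ.erase (j, false) := by
      cases b <;> simp_all
    exact Finset.le_sup (f := fun p => cancel (χ (bLetter p)) (χ (FreeGroup.of j))) hmem

theorem cancel_le_rightCancel (χ : FreeGroup ι →* FreeGroup κ) {p q : ι × Bool}
    (h : p.1 = q.1 → p.2 = q.2) :
    cancel (χ (bLetter p)) (χ (bLetter q)) ≤ rightCancel χ p := by
  rw [← cancel_inv_inv, ← map_inv, ← map_inv, ← bLetter_not, ← bLetter_not]
  refine (cancel_le_leftCancel χ (fun e => by simp [h e.symm])).trans ?_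
  obtain ⟨i, _ | _⟩ := p <;> rfl

theorem HasRemnant.norm_map_bLetter {χ : FreeGroup ι →* FreeGroup κ} (hχ : HasRemnant χ)
    (p : ι × Bool) : FreeGroup.norm (χ (bLetter p)) =
      leftCancel χ p + RemLen χ p.1 + rightCancel χ p := by
  have := hχ p.1
  rw [_root_.norm_map_bLetter, RemLen]
  obtain ⟨i, _ | _⟩ := p <;> simp only [leftCancel, rightCancel, cond] at this ⊢ <;> omega

theorem HasRemnant.remLen_pos {χ : FreeGroup ι →* FreeGroup κ} (hχ : HasRemnant χ) (i : ι) :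
    0 < RemLen χ i := by
  have := hχ i
  rw [RemLen]
  omega

open FreeGroup in
theorem HasRemnant.cancel_le_and_sum_remLen_le {χ : FreeGroup ι →* FreeGroup κ}
    (hχ : HasRemnant χ) (p : ι × Bool) (L : List (ι × Bool)) (h : IsReduced (p :: L)) :
    cancel (χ (bLetter p)) (χ (mk L)) ≤ rightCancel χ p ∧
      leftCancel χ p + ((p :: L).map fun q => RemLen χ q.1).sum ≤ norm (χ (mk (p :: L))) := by
  induction L generalizing p with
  | nil =>
    have := hχ.norm_map_bLetter p
    rw [mk_cons_eq_bLetter_mul, ← one_eq_mk, mul_one, _root_.map_one]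
    simp only [cancel, mul_one, FreeGroup.norm_one, List.map_cons, List.map_nil, List.sum_cons,
      List.sum_nil]
    omega
  | cons q L ih =>
    obtain ⟨hpq, hq⟩ := isReduced_cons_cons.1 h
    obtain ⟨ih₁, ih₂⟩ := ih q hq
    have hl := cancel_le_leftCancel χ hpq
    have hr := cancel_le_rightCancel χ hpq
    have hnq := hχ.norm_map_bLetter q
    have hpos := hχ.remLen_pos q.1
    have hc : cancel (χ (bLetter p)) (χ (mk (q :: L))) =
        cancel (χ (bLetter p)) (χ (bLetter q)) := by
      rw [mk_cons_eq_bLetter_mul q, _root_.map_mul]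
      exact cancel_mul_right_of_lt (by omega)
    have hnp := hχ.norm_map_bLetter p
    have hn := norm_mul_add_two_mul_cancel (χ (bLetter p)) (χ (mk (q :: L)))
    rw [mk_cons_eq_bLetter_mul p, _root_.map_mul, List.map_cons, List.sum_cons]
    omega

end

theorem norm_map_mk_le_sum {ι κ : Type*} [DecidableEq κ] (χ : FreeGroup ι →* FreeGroup κ)
    (L : List (ι × Bool)) : FreeGroup.norm (χ (FreeGroup.mk L)) ≤
      (L.map fun p => FreeGroup.norm (χ (FreeGroup.of p.1))).sum := by
  induction L with
  | nil => simp [← FreeGroup.one_eq_mk]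
  | cons p L ih =>
    rw [mk_cons_eq_bLetter_mul, map_mul, List.map_cons, List.sum_cons, ← norm_map_bLetter]
    exact (FreeGroup.norm_mul_le _ _).trans (by omega)

/-- Corollary 3.14: if `φ` has remnant with `|Rem_φ(aᵢ)| > |aᵢψ|` for every generator `aᵢ`,
then `Eq(φ, ψ) = {1}`. -/
theorem equalizer_trivial_of_remnant_inequality {n : ℕ} {κ : Type*} [DecidableEq κ]
    (φ ψ : FreeGroup (Fin n) →* FreeGroup κ)
    (hrem : HasRemnant φ)
    (hgt : ∀ i : Fin n, FreeGroup.norm (ψ (FreeGroup.of i)) < RemLen φ i) :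
    {g : FreeGroup (Fin n) | φ g = ψ g} = {1} := by
  ext g
  refine ⟨fun hg => ?_, fun hg => by simp [Set.mem_singleton_iff.1 hg]⟩
  rw [Set.mem_ofPred_eq] at hg
  rw [Set.mem_singleton_iff, ← FreeGroup.toWord_eq_nil_iff]
  by_contra hne
  obtain ⟨p, L, hpL⟩ := List.exists_cons_of_ne_nil hne
  have hred : FreeGroup.IsReduced (p :: L) := hpL ▸ FreeGroup.isReduced_toWord
  have hφ := (hrem.cancel_le_and_sum_remLen_le p L hred).2
  have hψ := norm_map_mk_le_sum ψ (p :: L)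
  have hlt : ((p :: L).map fun q => FreeGroup.norm (ψ (FreeGroup.of q.1))).sum <
      ((p :: L).map fun q => RemLen φ q.1).sum :=
    List.sum_lt_sum_of_ne_nil (by simp) _ _ fun q _ => hgt q.1
  rw [← hpL, FreeGroup.mk_toWord] at hφ hψ
  rw [hg] at hφ
  rw [← hpL] at hlt
  omega
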